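/- arXiv:2302.09050 — 2 statements merged into one kernel-verified Lean document; each statement's English description precedes it below -/
import Mathlib

section
/- Let H be a family of r distinct k-element subsets (edges) of a finite vertex set such that any two distinct edges intersect in exactly one vertex and no vertex belongs to three or more edges. Then for every m with 1 ≤ m ≤ r/2, the number of m-element sets S of vertices such that every vertex of S has degree exactly two in H (i.e. lies in exactly two edges) and no edge of H contains two vertices of S equals r!/((r-2m)! · m! · 2^m). -/
open Finset in
theorem aux_pairs {α : Type*} [Fintype α] [DecidableEq α] (H : Finset (Finset α))
    (hint : ∀ E ∈ H, ∀ F ∈ H, E ≠ F → (E ∩ F).card = 1)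
    (hdeg : ∀ v : α, (H.filter (fun E => v ∈ E)).card ≤ 2)
    (U : Finset (Finset α)) (hU : U ⊆ H) :
    ((univ : Finset α).filter (fun v => H.filter (fun E => v ∈ E) ∈ U.powersetCard 2)).card
      = U.card.choose 2 := by
  rw [← card_powersetCard]
  apply card_bij (fun v _ => H.filter (fun E => v ∈ E))
  · intro v hv
    exact (mem_filter.1 hv).2
  · intro v hv w hw h
    obtain ⟨hv1, hv2⟩ := mem_powersetCard.1 (mem_filter.1 hv).2
    obtain ⟨E, F, hEF, h2⟩ := card_eq_two.1 hv2
    have hE : E ∈ H.filter (fun E => v ∈ E) := by rw [h2]; simp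
    have hF : F ∈ H.filter (fun E => v ∈ E) := by rw [h2]; simp
    have hE' := hE
    have hF' := hF
    rw [h] at hE' hF'
    rw [mem_filter] at hE hF hE' hF'
    have := card_le_one.1 (hint E hE.1 F hF.1 hEF).le
    exact this v (by simp [hE.2, hF.2]) w (by simp [hE'.2, hF'.2])
  · intro p hp
    obtain ⟨hp1, hp2⟩ := mem_powersetCard.1 hp
    obtain ⟨E, F, hEF, h2⟩ := card_eq_two.1 hp2
    have hE : E ∈ H := hU (hp1 (by simp [h2]))
    have hF : F ∈ H := hU (hp1 (by simp [h2]))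
    obtain ⟨v, hv⟩ := card_eq_one.1 (hint E hE F hF hEF)
    have hv' : v ∈ E ∩ F := by simp [hv]
    rw [mem_inter] at hv'
    have key : p = H.filter (fun E => v ∈ E) := by
      apply eq_of_subset_of_card_le
      · intro G hG
        rw [h2] at hG
        simp only [mem_insert, mem_singleton] at hG
        rcases hG with rfl | rfl
        · exact mem_filter.2 ⟨hE, hv'.1⟩
        · exact mem_filter.2 ⟨hF, hv'.2⟩
      · rw [hp2]; exact hdeg v
    exact ⟨v, mem_filter.2 ⟨mem_univ _, key ▸ hp⟩, key.symm⟩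

open Finset in
theorem aux_indep {α : Type*} [DecidableEq α] (H : Finset (Finset α)) (S : Finset α) :
    (∀ E ∈ H, (E ∩ S).card ≤ 1) ↔
      ∀ v ∈ S, ∀ w ∈ S, v ≠ w → ∀ E ∈ H, v ∈ E → w ∉ E := by
  simp only [card_le_one, mem_inter]
  constructor
  · intro h v hv w hw hne E hE hvE hwE
    exact hne (h E hE v ⟨hvE, hv⟩ w ⟨hwE, hw⟩)
  · intro h E hE v hv w hw
    by_contra hne
    exact h v hv.2 w hw.2 hne E hE hv.1 hw.1

open Finset in
theorem aux_step {α : Type*} [Fintype α] [DecidableEq α] (H : Finset (Finset α))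
    (hint : ∀ E ∈ H, ∀ F ∈ H, E ≠ F → (E ∩ F).card = 1)
    (hdeg : ∀ v : α, (H.filter (fun E => v ∈ E)).card ≤ 2) (m : ℕ) :
    (((Finset.univ : Finset α).powersetCard m).filter
      (fun S => (∀ v ∈ S, (H.filter (fun E => v ∈ E)).card = 2) ∧
        ∀ E ∈ H, (E ∩ S).card ≤ 1)).card * (H.card - 2 * m).choose 2
    = (((Finset.univ : Finset α).powersetCard (m+1)).filter
      (fun S => (∀ v ∈ S, (H.filter (fun E => v ∈ E)).card = 2) ∧
        ∀ E ∈ H, (E ∩ S).card ≤ 1)).card * (m + 1) := by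
  simp only [aux_indep]
  apply card_mul_eq_card_mul (fun S T => S ⊆ T)
  · intro S hS
    simp only [mem_filter, mem_powersetCard, subset_univ, true_and] at hS
    obtain ⟨hc, h2, hi⟩ := hS
    set C := S.biUnion (fun v => H.filter (fun E => v ∈ E)) with hC
    have hCH : C ⊆ H := by
      intro E hE
      simp only [hC, mem_biUnion, mem_filter] at hE
      grind
    have hCc : C.card = 2 * m := by
      rw [hC, card_biUnion, sum_congr rfl h2]
      · simp [hc, mul_comm]
      · intro v hv w hw hne
        refine disjoint_left.2 ?_
        intro E hE hE'
        rw [mem_filter] at hE hE'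
        exact hi v hv w hw hne E hE.1 hE.2 hE'.2
    have hUc : (H \ C).card = H.card - 2 * m := by
      rw [card_sdiff_of_subset hCH, hCc]
    have hCm : ∀ E, E ∈ C ↔ ∃ v ∈ S, E ∈ H ∧ v ∈ E := by
      intro E; simp [hC]
    clear_value C
    rw [← hUc, ← aux_pairs H hint hdeg (H \ C) sdiff_subset]
    symm
    have hnot : ∀ v, H.filter (fun E => v ∈ E) ∈ (H \ C).powersetCard 2 → v ∉ S := by
      intro v hv hvS
      obtain ⟨hv1, hv2⟩ := mem_powersetCard.1 hv
      obtain ⟨E, hE⟩ := card_pos.1 (by rw [hv2]; norm_num : 0 < (H.filter (fun E => v ∈ E)).card)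
      have := (mem_sdiff.1 (hv1 hE)).2
      rw [mem_filter] at hE
      exact this ((hCm E).2 ⟨v, hvS, hE⟩)
    apply card_bij (fun v _ => insert v S)
    · intro v hv
      have hv := (mem_filter.1 hv).2
      have hvS := hnot v hv
      obtain ⟨hv1, hv2⟩ := mem_powersetCard.1 hv
      have hd : ∀ w ∈ S, ∀ E ∈ H, v ∈ E → w ∉ E := by
        intro w hw E hE hvE hwE
        exact (mem_sdiff.1 (hv1 (mem_filter.2 ⟨hE, hvE⟩))).2 ((hCm E).2 ⟨w, hw, hE, hwE⟩)
      simp only [mem_bipartiteAbove, mem_filter, mem_powersetCard, subset_univ, true_and]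
      refine ⟨⟨by rw [card_insert_of_notMem hvS, hc], ?_, ?_⟩, subset_insert _ _⟩
      · intro w hw
        rcases mem_insert.1 hw with rfl | hw
        · exact hv2
        · exact h2 w hw
      · intro x hx y hy hne E hE hxE hyE
        rcases mem_insert.1 hx with rfl | hx' <;> rcases mem_insert.1 hy with rfl | hy'
        · exact hne rfl
        · exact hd y hy' E hE hxE hyE
        · exact hd x hx' E hE hyE hxE
        · exact hi x hx' y hy' hne E hE hxE hyE
    · intro v hv w hw h
      have hv := hnot v (mem_filter.1 hv).2
      have : v ∈ insert w S := h ▸ mem_insert_self v S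
      rcases mem_insert.1 this with h | h
      · exact h
      · exact absurd h hv
    · intro T hT
      simp only [mem_bipartiteAbove, mem_filter, mem_powersetCard, subset_univ, true_and] at hT
      obtain ⟨⟨hTc, hT2, hTi⟩, hST⟩ := hT
      obtain ⟨v, hv⟩ := card_eq_one.1 (by rw [card_sdiff_of_subset hST]; omega : (T \ S).card = 1)
      have hvm : v ∈ T \ S := by simp [hv]
      rw [mem_sdiff] at hvm
      refine ⟨v, mem_filter.2 ⟨mem_univ _, mem_powersetCard.2 ⟨?_, hT2 v hvm.1⟩⟩, ?_⟩
      · intro E hE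
        rw [mem_filter] at hE
        refine mem_sdiff.2 ⟨hE.1, fun hEC => ?_⟩
        obtain ⟨w, hw, _, hwE⟩ := (hCm E).1 hEC
        exact hTi v hvm.1 w (hST hw) (fun h => hvm.2 (h ▸ hw)) E hE.1 hE.2 hwE
      · apply eq_of_subset_of_card_le
        · exact insert_subset hvm.1 hST
        · rw [card_insert_of_notMem hvm.2]; omega
  · intro T hT
    simp only [mem_filter, mem_powersetCard, subset_univ, true_and] at hT
    obtain ⟨hc, h2, hi⟩ := hT
    have : bipartiteBelow (fun S T => S ⊆ T) (((Finset.univ : Finset α).powersetCard m).filter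
      (fun S => (∀ v ∈ S, (H.filter (fun E => v ∈ E)).card = 2) ∧
        ∀ v ∈ S, ∀ w ∈ S, v ≠ w → ∀ E ∈ H, v ∈ E → w ∉ E)) T = T.powersetCard m := by
      ext S
      simp only [mem_bipartiteBelow, mem_filter, mem_powersetCard, subset_univ, true_and]
      constructor
      · rintro ⟨⟨a, _⟩, b⟩
        exact ⟨b, a⟩
      · rintro ⟨b, a⟩
        exact ⟨⟨a, fun v hv => h2 v (b hv), fun v hv w hw => hi v (b hv) w (b hw)⟩, b⟩
    rw [this, card_powersetCard, hc, Nat.choose_succ_self_right]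

open Finset in
theorem aux_main {α : Type*} [Fintype α] [DecidableEq α] (H : Finset (Finset α))
    (hint : ∀ E ∈ H, ∀ F ∈ H, E ≠ F → (E ∩ F).card = 1)
    (hdeg : ∀ v : α, (H.filter (fun E => v ∈ E)).card ≤ 2) (m : ℕ) (hm : 2 * m ≤ H.card) :
    (((Finset.univ : Finset α).powersetCard m).filter
      (fun S => (∀ v ∈ S, (H.filter (fun E => v ∈ E)).card = 2) ∧
        ∀ E ∈ H, (E ∩ S).card ≤ 1)).card * ((H.card - 2 * m).factorial * m.factorial * 2 ^ m)
    = H.card.factorial := by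
  induction m with
  | zero => simp [filter_singleton]
  | succ m ih =>
    have ih := ih (by omega)
    have hs := aux_step H hint hdeg m
    have hf := Nat.choose_mul_factorial_mul_factorial (n := H.card - 2 * m) (k := 2) (by omega)
    rw [show H.card - 2 * m - 2 = H.card - 2 * (m + 1) by omega] at hf
    rw [← ih, ← hf, Nat.factorial_succ, pow_succ, Nat.factorial_two]
    generalize (H.card - 2 * (m + 1)).factorial = a at *
    generalize (H.card - 2 * m).choose 2 = c at *
    have := congrArg (fun x => x * (a * m.factorial * 2 ^ m * 2)) hs
    linarith

/-- Counting independent sets of degree-two vertices in a linear (every two edges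
meet in exactly one vertex), maximum-degree-two, `k`-uniform hypergraph with `r` edges. -/
theorem stmt_0 {α : Type*} [Fintype α] [DecidableEq α] (H : Finset (Finset α))
    (r k : ℕ) (hr : H.card = r) (hk : ∀ E ∈ H, E.card = k)
    (hint : ∀ E ∈ H, ∀ F ∈ H, E ≠ F → (E ∩ F).card = 1)
    (hdeg : ∀ v : α, (H.filter (fun E => v ∈ E)).card ≤ 2)
    (m : ℕ) (hm1 : 1 ≤ m) (hm2 : 2 * m ≤ r) :
    (((Finset.univ : Finset α).powersetCard m).filter
      (fun S => (∀ v ∈ S, (H.filter (fun E => v ∈ E)).card = 2) ∧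
        ∀ E ∈ H, (E ∩ S).card ≤ 1)).card
      = r.factorial / ((r - 2 * m).factorial * m.factorial * 2 ^ m) := by

  subst hr
  rw [← aux_main H hint hdeg m hm2]
  exact (Nat.mul_div_cancel _ (by positivity)).symm
end

section
/- Let (Ω, 𝓕, P) be a probability space with a filtration (𝓕_j)_{j∈ℕ}, and let (Y_j)_{j∈ℕ} be a supermartingale with respect to this filtration such that |Y_{j+1} − Y_j| ≤ C almost surely for all j, where C > 0 is a constant. For m ∈ ℕ let W_m = ∑_{j<m} Var(Y_{j+1} − Y_j | 𝓕_j) denote the accumulated conditional variance, where Var(Z | 𝓕_j) = E[Z² | 𝓕_j] − (E[Z | 𝓕_j])². Then for all reals λ > 0 and b > 0, P( ∃ m : W_m ≤ b and Y_m − Y_0 ≥ λ ) ≤ exp( −λ² / (2(b + Cλ)) ). -/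
open MeasureTheory

theorem fr_exp_bound {a y : ℝ} (ha : a < 1) (hy : y ≤ 2 * a) (ha0 : 0 ≤ a) :
    Real.exp y ≤ 1 + y + y ^ 2 / (2 * (1 - a)) := by
  rcases le_or_gt 0 y with h | h
  · have h1 : |y / 2| < 1 := by rw [abs_of_nonneg (by linarith)]; linarith
    have h2 := Real.hasSum_log_sub_log_of_abs_lt_one h1
    have h3 := le_hasSum h2 0 (fun k _ => by positivity)
    have h3' : y ≤ Real.log (1 + y / 2) - Real.log (1 - y / 2) := by
      norm_num at h3; linarith
    have h4 : Real.exp y ≤ (1 + y / 2) / (1 - y / 2) := by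
      rw [← Real.log_div (by linarith) (by linarith)] at h3'
      have := Real.exp_le_exp.2 h3'
      rwa [Real.exp_log (div_pos (by linarith) (by linarith))] at this
    have h5 : (1 + y / 2) / (1 - y / 2) = 1 + y + y ^ 2 / (2 * (1 - y / 2)) := by
      have : 1 - y / 2 ≠ 0 := by linarith
      have : 2 - y ≠ 0 := by linarith
      field_simp
      ring
    rw [h5] at h4
    refine h4.trans ?_
    have : y ^ 2 / (2 * (1 - y / 2)) ≤ y ^ 2 / (2 * (1 - a)) := by
      apply div_le_div_of_nonneg_left (by positivity) (by linarith) (by linarith)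
    linarith
  · have h1 := Real.quadratic_le_exp_of_nonneg (x := -y) (by linarith)
    have h2 : Real.exp y * Real.exp (-y) = 1 := by rw [← Real.exp_add]; simp
    have h3 := Real.exp_pos y
    have h4 : Real.exp y ≤ 1 + y + y ^ 2 / 2 := by
      have h6 : (1 + y + y ^ 2 / 2) * (1 + -y + (-y) ^ 2 / 2) = 1 + y ^ 4 / 4 := by ring
      have h7 : 0 < 1 + -y + (-y) ^ 2 / 2 := by nlinarith
      have h8 : Real.exp y * (1 + -y + (-y) ^ 2 / 2) ≤ 1 := by
        exact (mul_le_mul_of_nonneg_left h1 h3.le).trans h2.le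
      have h9 : 0 ≤ y ^ 4 / 4 := by positivity
      refine le_of_mul_le_mul_right ?_ h7
      linarith
    have : y ^ 2 / 2 ≤ y ^ 2 / (2 * (1 - a)) := by
      apply div_le_div_of_nonneg_left (by positivity) (by linarith) (by linarith)
    linarith

theorem fr_max {Ω : Type*} {m0 : MeasurableSpace Ω} {μ : Measure Ω}
    [IsProbabilityMeasure μ] (ℱ : Filtration ℕ m0) (M : ℕ → Ω → ℝ)
    (hM : Supermartingale M ℱ μ) (hpos : ∀ n ω, 0 ≤ M n ω) (h0 : ∫ ω, M 0 ω ∂μ ≤ 1)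
    (c : ℝ) (hc : 0 < c) :
    μ {ω | ∃ n, c ≤ M n ω} ≤ ENNReal.ofReal c⁻¹ := by
  let B : ℕ → Set Ω := fun n => {ω | ∀ k ≤ n, M k ω < c}
  have hBF : ∀ n, MeasurableSet[ℱ n] (B n) := by
    intro n
    have : B n = ⋂ k, ⋂ (_ : k ≤ n), {ω | M k ω < c} := by ext; simp [B]
    rw [this]
    refine MeasurableSet.iInter fun k => MeasurableSet.iInter fun hk => ?_
    exact ℱ.mono hk _ ((hM.1 k).measurable measurableSet_Iio)
  have hB : ∀ n, MeasurableSet (B n) := fun n => ℱ.le n _ (hBF n)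
  have key : ∀ n, c * μ.real (B n)ᶜ + ∫ ω in B n, M n ω ∂μ ≤ 1 := by
    intro n
    induction n with
    | zero =>
      have h1 : c * μ.real (B 0)ᶜ ≤ ∫ ω in (B 0)ᶜ, M 0 ω ∂μ := by
        apply setIntegral_ge_of_const_le_real (hB 0).compl (measure_ne_top _ _)
        · intro ω hω; simpa [B] using hω
        · exact (hM.integrable 0).integrableOn
      have h2 := integral_add_compl (hB 0) (hM.integrable 0)
      linarith
    | succ n ih =>
      have hD : MeasurableSet (B n \ B (n+1)) := (hB n).diff (hB _)
      have hsub : B (n+1) ⊆ B n := fun ω h k hk => h k (by omega)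
      have h1 : c * μ.real (B n \ B (n+1)) ≤ ∫ ω in B n \ B (n+1), M (n+1) ω ∂μ := by
        apply setIntegral_ge_of_const_le_real hD (measure_ne_top _ _)
        · rintro ω ⟨h1, h2⟩
          by_contra! h3
          apply h2
          intro k hk
          rcases Nat.lt_or_ge n k with h | h
          · obtain rfl : k = n + 1 := by omega
            exact h3
          · exact h1 k h
        · exact (hM.integrable _).integrableOn
      have h2 := hM.setIntegral_le (Nat.le_succ n) (hBF n)
      have h3 : ∫ ω in B n, M (n+1) ω ∂μ = (∫ ω in B (n+1), M (n+1) ω ∂μ) +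
          ∫ ω in B n \ B (n+1), M (n+1) ω ∂μ := by
        rw [← setIntegral_union Set.disjoint_sdiff_right hD (hM.integrable _).integrableOn
          (hM.integrable _).integrableOn, Set.union_sdiff_cancel hsub]
      have h4 : μ.real (B (n+1))ᶜ = μ.real (B n)ᶜ + μ.real (B n \ B (n+1)) := by
        have e : (B (n+1))ᶜ = (B n)ᶜ ∪ (B n \ B (n+1)) := by
          ext ω
          have := @hsub ω
          simp only [Set.mem_compl_iff, Set.mem_union, Set.mem_diff]
          tauto
        rw [e, measureReal_union _ hD]
        exact Set.disjoint_left.2 fun ω h h' => h h'.1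
      rw [h4]
      simp only [Nat.succ_eq_add_one] at h2
      linarith
  have e : {ω | ∃ n, c ≤ M n ω} = ⋃ n, (B n)ᶜ := by
    ext ω
    simp only [Set.mem_setOf_eq, Set.mem_iUnion, Set.mem_compl_iff, B, not_forall, not_lt]
    exact ⟨fun ⟨n, h⟩ => ⟨n, n, le_rfl, h⟩, fun ⟨_, k, _, h⟩ => ⟨k, h⟩⟩
  have hmono : Monotone fun n => (B n)ᶜ := by
    intro i j hij
    exact Set.compl_subset_compl.2 fun ω h k hk => h k (hk.trans hij)
  rw [e, hmono.measure_iUnion]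
  refine iSup_le fun n => ?_
  rw [← ofReal_measureReal]
  apply ENNReal.ofReal_le_ofReal
  have h1 : 0 ≤ ∫ ω in B n, M n ω ∂μ := integral_nonneg (hpos n)
  have := key n
  rw [← one_div, le_div_iff₀ hc]
  linarith

open ProbabilityTheory in
theorem fr_cond {Ω : Type*} {m m0 : MeasurableSpace Ω} {μ : Measure Ω}
    [IsProbabilityMeasure μ] (hm : m ≤ m0) (X : Ω → ℝ) (hX : Integrable X μ)
    (C : ℝ) (hC : 0 < C) (hb : ∀ᵐ ω ∂μ, |X ω| ≤ C)
    (hneg : ∀ᵐ ω ∂μ, (μ[X|m]) ω ≤ 0) (t : ℝ) (ht : 0 ≤ t) (htC : t * C < 1) :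
    Integrable (fun ω => Real.exp (t * X ω)) μ ∧
    (∀ᵐ ω ∂μ, 0 ≤ (μ[fun ω => X ω ^ 2|m]) ω - ((μ[X|m]) ω) ^ 2) ∧
    ∀ᵐ ω ∂μ, (μ[fun ω => Real.exp (t * X ω)|m]) ω ≤
      Real.exp (t ^ 2 / (2 * (1 - t * C)) *
        ((μ[fun ω => X ω ^ 2|m]) ω - ((μ[X|m]) ω) ^ 2)) := by
  set g := t ^ 2 / (2 * (1 - t * C)) with hg
  have hL : MemLp X 2 μ := MemLp.of_bound hX.1 C (by simpa using hb)
  have hV := condVar_ae_eq_condExp_sq_sub_sq_condExp hm hL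
  have hDb : ∀ᵐ ω ∂μ, |(μ[X|m]) ω| ≤ C :=
    ae_bdd_condExp_of_ae_bdd (R := ⟨C, hC.le⟩) hb
  have hE : Integrable (fun ω => Real.exp (t * X ω)) μ := by
    refine Integrable.of_bound (Real.continuous_exp.comp_aestronglyMeasurable
      (hX.1.const_mul t)) (Real.exp (t * C)) ?_
    filter_upwards [hb] with ω h
    rw [Real.norm_eq_abs, Real.abs_exp, Real.exp_le_exp]
    exact mul_le_mul_of_nonneg_left (le_of_abs_le h) ht
  have hnn : 0 ≤ᵐ[μ] Var[X; μ | m] := condExp_nonneg (ae_of_all _ fun ω => by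
    simp only [Pi.zero_apply, Pi.pow_apply]; positivity)
  have hsq : Integrable ((X - μ[X|m]) ^ 2) μ :=
    (hL.sub (hL.condExp one_le_two)).integrable_sq
  refine ⟨hE, ?_, ?_⟩
  · filter_upwards [hV, hnn] with ω h1 h2
    rw [h1] at h2
    exact h2
  have hc : Integrable (X - μ[X|m]) μ := hX.sub integrable_condExp
  have i1 : Integrable (t • (X - μ[X|m])) μ := hc.smul t
  have i2 : Integrable (g • (X - μ[X|m]) ^ 2) μ := hsq.smul g
  have i0 : Integrable (fun _ : Ω => (1:ℝ)) μ := integrable_const _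
  have hle : (fun ω => Real.exp (t * X ω)) ≤ᵐ[μ]
      (fun _ => (1:ℝ)) + t • (X - μ[X|m]) + g • (X - μ[X|m]) ^ 2 := by
    filter_upwards [hb, hDb, hneg] with ω h1 h2 h3
    simp only [Pi.add_apply, Pi.smul_apply, Pi.sub_apply, Pi.pow_apply, smul_eq_mul]
    set D := (μ[X|m]) ω
    have h4 : Real.exp (t * X ω) ≤ Real.exp (t * (X ω - D)) := by
      apply Real.exp_le_exp.2
      nlinarith
    have h5 : t * (X ω - D) ≤ 2 * (t * C) := by
      have : X ω - D ≤ 2 * C := by linarith [abs_le.1 h1, abs_le.1 h2]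
      nlinarith
    have h6 := fr_exp_bound htC h5 (by positivity)
    have h7 : (t * (X ω - D)) ^ 2 / (2 * (1 - t * C)) = g * (X ω - D) ^ 2 := by
      rw [hg]; ring
    linarith
  have h1 := condExp_mono (m := m) hE ((i0.add i1).add i2) hle
  have h2 := condExp_add (m := m) (i0.add i1) i2
  have h3 := condExp_add (m := m) i0 i1
  have h4 := condExp_smul (m := m) (μ := μ) t (X - μ[X|m])
  have h5 := condExp_smul (m := m) (μ := μ) g ((X - μ[X|m]) ^ 2)
  have h6 := condExp_sub (m := m) hX (integrable_condExp (f := X) (m := m) (μ := μ))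
  have h7 : μ[μ[X|m]|m] = μ[X|m] :=
    condExp_of_stronglyMeasurable hm stronglyMeasurable_condExp integrable_condExp
  filter_upwards [h1, h2, h3, h4, h5, h6, hV] with ω h1 h2 h3 h4 h5 h6 hV
  rw [h7] at h6
  simp only [condVar, Pi.add_apply, Pi.smul_apply, Pi.sub_apply, Pi.pow_apply, smul_eq_mul] at *
  rw [h2, h3, h4, h5, h6, condExp_const hm, hV] at h1
  have := Real.add_one_le_exp (g * ((μ[fun ω => X ω ^ 2|m]) ω - ((μ[X|m]) ω) ^ 2))
  have e : (X ^ 2) = fun ω => X ω ^ 2 := rfl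
  rw [e] at h1
  linarith

/-- Freedman's inequality: if `(Y_j)` is a supermartingale with increments
bounded by `C` and `W_m` denotes the accumulated conditional variance of the
increments, then for `λ, b > 0`,
`P(∃ m, W_m ≤ b ∧ Y_m - Y_0 ≥ λ) ≤ exp(-λ²/(2(b + Cλ)))`. -/
theorem stmt_14 {Ω : Type*} {m0 : MeasurableSpace Ω} {μ : Measure Ω}
    [IsProbabilityMeasure μ] (ℱ : Filtration ℕ m0)
    (Y : ℕ → Ω → ℝ) (hY : Supermartingale Y ℱ μ)
    (C : ℝ) (hC : 0 < C)
    (hbdd : ∀ j : ℕ, ∀ᵐ ω ∂μ, |Y (j + 1) ω - Y j ω| ≤ C)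
    (W : ℕ → Ω → ℝ)
    (hW : ∀ m ω, W m ω = ∑ j ∈ Finset.range m,
      ((μ[fun ω' => (Y (j + 1) ω' - Y j ω') ^ 2|ℱ j]) ω
        - ((μ[fun ω' => Y (j + 1) ω' - Y j ω'|ℱ j]) ω) ^ 2))
    (lam b : ℝ) (hlam : 0 < lam) (hb : 0 < b) :
    μ {ω | ∃ m : ℕ, W m ω ≤ b ∧ lam ≤ Y m ω - Y 0 ω}
      ≤ ENNReal.ofReal (Real.exp (-lam ^ 2 / (2 * (b + C * lam)))) := by
  have hden : 0 < b + C * lam := by positivity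
  obtain ⟨t, ht⟩ : ∃ t, t = lam / (b + C * lam) := ⟨_, rfl⟩
  have ht0 : 0 < t := by rw [ht]; positivity
  have htC' : 1 - t * C = b / (b + C * lam) := by rw [ht]; field_simp; ring
  have htC : t * C < 1 := by
    have : 0 < b / (b + C * lam) := by positivity
    linarith
  obtain ⟨g, hg⟩ : ∃ g, g = t ^ 2 / (2 * (1 - t * C)) := ⟨_, rfl⟩
  have hg0 : 0 ≤ g := by
    rw [hg]; exact div_nonneg (by positivity) (by linarith)
  have hexp : -(t * lam - g * b) = -lam ^ 2 / (2 * (b + C * lam)) := by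
    rw [hg, htC', ht]; field_simp; ring
  obtain ⟨V, hV⟩ : ∃ V : ℕ → Ω → ℝ, V = fun j ω =>
      (μ[fun ω' => (Y (j + 1) ω' - Y j ω') ^ 2|ℱ j]) ω
        - ((μ[fun ω' => Y (j + 1) ω' - Y j ω'|ℱ j]) ω) ^ 2 := ⟨_, rfl⟩
  have hWV : ∀ m ω, W m ω = ∑ j ∈ Finset.range m, V j ω := by
    intro m ω; rw [hW, hV]
  have hVm : ∀ j, StronglyMeasurable[ℱ j] (V j) := by
    intro j; rw [hV]
    exact stronglyMeasurable_condExp.sub (stronglyMeasurable_condExp.pow 2)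
  have hXi : ∀ j, Integrable (fun ω => Y (j + 1) ω - Y j ω) μ :=
    fun j => (hY.integrable _).sub (hY.integrable _)
  have hneg : ∀ j, ∀ᵐ ω ∂μ, (μ[fun ω' => Y (j + 1) ω' - Y j ω'|ℱ j]) ω ≤ 0 := by
    intro j
    have h1 := condExp_sub (m := ℱ j) (hY.integrable (j+1)) (hY.integrable j)
    have h2 := hY.condExp_ae_le (Nat.le_succ j)
    have h3 := condExp_of_stronglyMeasurable (ℱ.le j) (hY.1 j) (hY.integrable j)
    filter_upwards [h1, h2] with ω h1 h2
    have h4 : (μ[fun ω' => Y (j + 1) ω' - Y j ω'|ℱ j]) ω = _ := h1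
    rw [h4, h3, Pi.sub_apply]
    simpa using h2
  have hcond := fun j => fr_cond (ℱ.le j) _ (hXi j) C hC (hbdd j) (hneg j) t ht0.le htC
  rw [← hg] at hcond
  have hV0 : ∀ j, ∀ᵐ ω ∂μ, 0 ≤ V j ω := by
    intro j; rw [hV]; exact (hcond j).2.1
  have hVe : ∀ j, ∀ᵐ ω ∂μ, (μ[fun ω => Real.exp (t * (Y (j + 1) ω - Y j ω))|ℱ j]) ω ≤
      Real.exp (g * V j ω) := by
    intro j; rw [hV]; exact (hcond j).2.2
  obtain ⟨M, hM⟩ : ∃ M : ℕ → Ω → ℝ, M = fun n ω =>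
    Real.exp (t * (Y n ω - Y 0 ω) - g * W n ω) := ⟨_, rfl⟩
  have hWm : ∀ n, ∀ k, n ≤ k + 1 → StronglyMeasurable[ℱ k] (W n) := by
    intro n k hk
    have : W n = fun ω => ∑ j ∈ Finset.range n, V j ω := funext (hWV n)
    rw [this]
    refine Finset.stronglyMeasurable_fun_sum _ fun j hj => ?_
    exact (hVm j).mono (ℱ.mono (by have := Finset.mem_range.1 hj; omega))
  have hYm : ∀ n, StronglyMeasurable[ℱ n] fun ω => Y n ω - Y 0 ω := fun n =>
    (hY.1 n).sub ((hY.1 0).mono (ℱ.mono (Nat.zero_le n)))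
  have hMm : ∀ n, StronglyMeasurable[ℱ n] (M n) := by
    intro n; rw [hM]
    exact Real.continuous_exp.comp_stronglyMeasurable
      (((hYm n).const_mul t).sub ((hWm n n (by omega)).const_mul g))
  have hbddn : ∀ n, ∀ᵐ ω ∂μ, Y n ω - Y 0 ω ≤ n * C := by
    intro n
    filter_upwards [ae_all_iff.2 hbdd] with ω h
    induction n with
    | zero => simp
    | succ n ih =>
      have := le_of_abs_le (h n)
      push_cast
      linarith
  have hMi : ∀ n, Integrable (M n) μ := by
    intro n
    refine Integrable.of_bound ((hMm n).mono (ℱ.le n)).aestronglyMeasurable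
      (Real.exp (t * (n * C))) ?_
    filter_upwards [hbddn n, ae_all_iff.2 hV0] with ω h1 h2
    rw [hM, Real.norm_eq_abs, Real.abs_exp, Real.exp_le_exp]
    have h3 : 0 ≤ W n ω := by
      rw [hWV]; exact Finset.sum_nonneg fun j _ => h2 j
    have := mul_le_mul_of_nonneg_left h1 ht0.le
    have := mul_nonneg hg0 h3
    linarith
  have hsup : Supermartingale M ℱ μ := by
    refine supermartingale_nat hMm hMi fun n => ?_
    let N : Ω → ℝ := fun ω => Real.exp (t * (Y n ω - Y 0 ω) - g * W (n+1) ω)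
    have hN : StronglyMeasurable[ℱ n] N := Real.continuous_exp.comp_stronglyMeasurable
      (((hYm n).const_mul t).sub ((hWm (n+1) n (by omega)).const_mul g))
    have e : M (n+1) = N * fun ω => Real.exp (t * (Y (n + 1) ω - Y n ω)) := by
      ext ω
      simp only [hM, N, Pi.mul_apply, ← Real.exp_add]
      congr 1; ring
    have h1 := condExp_mul_of_stronglyMeasurable_left hN (e ▸ hMi (n+1)) (hcond n).1
    rw [e]
    filter_upwards [h1, hVe n] with ω h1 h2
    rw [h1, Pi.mul_apply]
    refine (mul_le_mul_of_nonneg_left h2 (Real.exp_pos _).le).trans (le_of_eq ?_)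
    simp only [hM, N, ← Real.exp_add, hWV, Finset.sum_range_succ]
    congr 1; ring
  have hfin := fr_max ℱ M hsup (fun n ω => by rw [hM]; exact (Real.exp_pos _).le)
    (by simp [hM, hWV]) (Real.exp (t * lam - g * b)) (Real.exp_pos _)
  rw [← Real.exp_neg, hexp] at hfin
  refine (measure_mono ?_).trans hfin
  rintro ω ⟨n, h1, h2⟩
  refine ⟨n, ?_⟩
  rw [hM]
  apply Real.exp_le_exp.2
  have := mul_le_mul_of_nonneg_left h1 hg0
  have := mul_le_mul_of_nonneg_left h2 ht0.le
  linarith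
end
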